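/- Let U ⊆ ℝ^d be an open co-regular set. Then for every bounded continuous function f : C_∞ → ℝ, the map (x, t) ↦ W̃^U_{x,t}(f) is continuous on U × (0, ∞). -/

import Mathlib

open MeasureTheory ProbabilityTheory Filter Topology NNReal ENNReal

noncomputable section

abbrev E (d : ℕ) : Type := EuclideanSpace ℝ (Fin d)

abbrev PathSpace (d : ℕ) : Type := C(ℝ≥0, E d)

instance (d : ℕ) : MeasurableSpace (PathSpace d) := borel _
instance (d : ℕ) : BorelSpace (PathSpace d) := ⟨rfl⟩

/-- `W` is the family of laws of standard `d`-dimensional Brownian motion: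
`W x` is a probability measure on path space, starting a.s. at `x`, whose
increments have the finite-dimensional distributions of Brownian motion
(independent centered Gaussian coordinates with the right variances). -/
def IsWiener {d : ℕ} (W : E d → Measure (PathSpace d)) : Prop :=
  ∀ x : E d, IsProbabilityMeasure (W x) ∧ (W x) {w | w 0 = x} = 1 ∧
    ∀ (n : ℕ) (t : Fin (n + 1) → ℝ≥0), Monotone t →
      (W x).map (fun w (p : Fin n × Fin d) => w (t p.1.succ) p.2 - w (t p.1.castSucc) p.2)
        = Measure.pi (fun p : Fin n × Fin d => gaussianReal 0 (t p.1.succ - t p.1.castSucc))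

/-- First exit time from `U` : `τ_U = inf {t > 0 : X_t ∉ U}` (with value `∞` if the
path never leaves `U`). -/
def exitTime {d : ℕ} (U : Set (E d)) (w : PathSpace d) : ℝ≥0∞ :=
  sInf (((↑) : ℝ≥0 → ℝ≥0∞) '' {t : ℝ≥0 | 0 < t ∧ w t ∉ U})

/-- The law `W̃^U_{x,1}` of Brownian motion started at `x` conditioned to stay in `U`
for a unit of time. -/
def condLaw {d : ℕ} (W : E d → Measure (PathSpace d)) (U : Set (E d)) (x : E d) :
    Measure (PathSpace d) :=
  ProbabilityTheory.cond (W x) {w | 1 < exitTime U w}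


/-- `W̃^U_{x,t} = W_x(· | τ_U > t)` for a real time `t > 0` (convention `W_x` for `t ≤ 0`). -/
def condLawT {d : ℕ} (W : E d → Measure (PathSpace d)) (U : Set (E d)) (x : E d) (t : ℝ) :
    Measure (PathSpace d) :=
  if t ≤ 0 then W x
  else ProbabilityTheory.cond (W x) {w | ENNReal.ofReal t < exitTime U w}

/-- `U` is *co-regular* if Brownian motion started at any boundary point of `U` leaves the
closure of `U` instantaneously: `W_x(τ_{cl U} > 0) = 0` for every `x ∈ ∂U`. -/
def IsCoRegular {d : ℕ} (W : E d → Measure (PathSpace d)) (U : Set (E d)) : Prop :=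
  ∀ x ∈ frontier U, W x {w | 0 < exitTime (closure U) w} = 0

/-- The increments of a path along a finite grid, coordinate by coordinate. -/
def increments {d n : ℕ} (t : Fin (n + 1) → ℝ≥0) (w : PathSpace d) (p : Fin n × Fin d) : ℝ :=
  w (t p.1.succ) p.2 - w (t p.1.castSucc) p.2

/-- `μ` is the law of a `d`-dimensional Brownian motion started at `x`. -/
def IsBrownianLaw {d : ℕ} (x : E d) (μ : Measure (PathSpace d)) : Prop :=
  IsProbabilityMeasure μ ∧ μ {w | w 0 = x} = 1 ∧
    ∀ (n : ℕ) (t : Fin (n + 1) → ℝ≥0), Monotone t →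
      μ.map (increments t)
        = Measure.pi (fun p : Fin n × Fin d => gaussianReal 0 (t p.1.succ - t p.1.castSucc))

variable {d : ℕ}

lemma IsWiener.isBrownianLaw {W : E d → Measure (PathSpace d)} (hW : IsWiener W) (x : E d) :
    IsBrownianLaw x (W x) := hW x

@[fun_prop]
lemma continuous_eval (t : ℝ≥0) : Continuous fun w : PathSpace d => w t :=
  continuous_eval_const t

@[fun_prop]
lemma measurable_eval (t : ℝ≥0) : Measurable fun w : PathSpace d => w t :=
  (continuous_eval t).measurable

/-- The Borel σ-algebra of path space is generated by the evaluations. -/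
lemma pathSpace_measurableSpace_eq :
    instMeasurableSpacePathSpace d
      = MeasurableSpace.comap (fun w : PathSpace d => (w : ℝ≥0 → E d)) MeasurableSpace.pi := by
  have hcoe : Measurable fun w : PathSpace d => (w : ℝ≥0 → E d) :=
    measurable_pi_lambda _ fun t => measurable_eval t
  set m := MeasurableSpace.comap (fun w : PathSpace d => (w : ℝ≥0 → E d)) MeasurableSpace.pi
    with hm
  have heval : ∀ t : ℝ≥0, Measurable[m] fun w : PathSpace d => w t := fun t =>
    (measurable_pi_apply t).comp (comap_measurable _)
  apply le_antisymm
  · change borel (PathSpace d) ≤ m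
    rw [borel_eq_generateFrom_of_subbasis ContinuousMap.compactOpen_eq]
    refine MeasurableSpace.generateFrom_le ?_
    rintro _ ⟨K, hK, V, hV, rfl⟩
    have hV' : IsOpen V := hV
    let F : ℕ → Set (E d) := fun n => {y | ((n : ℝ≥0∞) + 1)⁻¹ ≤ Metric.infEDist y Vᶜ}
    have hFc : ∀ n, IsClosed (F n) := fun n =>
      isClosed_le continuous_const Metric.continuous_infEDist
    obtain ⟨D, hDK, hDc, hD⟩ := 
      (TopologicalSpace.IsSeparable.of_separableSpace K).exists_countable_dense_subset
    have : {f : PathSpace d | Set.MapsTo f K V} = ⋃ n, ⋂ u ∈ D, {f : PathSpace d | f u ∈ F n} := by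
      ext f
      simp only [Set.mem_ofPred_eq, Set.mem_iUnion, Set.mem_iInter]
      constructor
      · intro hf
        obtain ⟨δ, hδ, hδV⟩ := (IsCompact.image (id hK : IsCompact K)
          f.continuous).exists_thickening_subset_open hV' hf.image_subset
        obtain ⟨n, hn⟩ := ENNReal.exists_inv_nat_lt (ENNReal.ofReal_pos.mpr hδ).ne'
        refine ⟨n, fun u hu => ?_⟩
        refine le_trans ((ENNReal.inv_le_inv.mpr le_self_add).trans hn.le) ?_
        refine Metric.le_infEDist.mpr fun y hy => ?_
        by_contra! hlt
        refine hy (hδV (Metric.mem_thickening_iff.mpr ⟨f u, ⟨u, hDK hu, rfl⟩, ?_⟩))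
        rwa [edist_comm, edist_lt_ofReal] at hlt
      · rintro ⟨n, hn⟩ u hu
        have : u ∈ f ⁻¹' F n :=
          closure_minimal (fun v hv => hn v hv) ((hFc n).preimage f.continuous) (hD hu)
        by_contra hV
        have h0 : Metric.infEDist (f u) Vᶜ = 0 := Metric.infEDist_zero_of_mem hV
        have h1 : ((n : ℝ≥0∞) + 1)⁻¹ ≤ Metric.infEDist (f u) Vᶜ := this
        rw [h0] at h1
        simp at h1
    change MeasurableSet[m] {f : PathSpace d | Set.MapsTo f K V}
    rw [this]
    exact MeasurableSet.iUnion fun n => MeasurableSet.biInter hDc fun u _ =>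
      heval u (hFc n).measurableSet
  · exact hcoe.comap_le

/-- Telescoping of the increments along a grid. -/
lemma sub_eq_sum_increments {n : ℕ} (t : Fin (n + 1) → ℝ≥0) (w : PathSpace d) (c : Fin d)
    {l k : Fin (n + 1)} (hlk : l ≤ k) :
    w (t k) c - w (t l) c
      = ∑ j : Fin n, if l ≤ j.castSucc ∧ j.castSucc < k then increments t w (j, c) else 0 := by
  induction k using Fin.induction with
  | zero =>
    obtain rfl : l = 0 := Fin.le_zero_iff.mp hlk
    simp
  | succ k ih =>
    rcases hlk.eq_or_lt with rfl | h
    · rw [sub_self, Finset.sum_eq_zero]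
      intro j _
      rw [if_neg]
      rintro ⟨h1, h2⟩
      exact absurd (h1.trans_lt h2) (lt_irrefl _)
    · have hl : l ≤ k.castSucc := Fin.le_castSucc_iff.mpr h
      have hs : ∀ j : Fin n, (if l ≤ j.castSucc ∧ j.castSucc < k.succ then increments t w (j, c)
          else 0) = (if l ≤ j.castSucc ∧ j.castSucc < k.castSucc then increments t w (j, c) else 0)
            + if j = k then increments t w (j, c) else 0 := by
        intro j
        rcases lt_trichotomy j k with hj | rfl | hj
        · have : j.castSucc < k.succ := by grind
          simp [hj, hj.ne, this]
        · simp [hl]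
        · have : ¬ j.castSucc < k.succ := by grind
          simp [hj.not_gt, hj.ne', this]
      rw [Finset.sum_congr rfl fun j _ => hs j, Finset.sum_add_distrib, ← ih hl]
      simp [increments]

@[fun_prop]
lemma measurable_increments {n : ℕ} (t : Fin (n + 1) → ℝ≥0) :
    Measurable (increments (d := d) t) := by
  unfold increments
  fun_prop

lemma exists_grid (L : Finset ℝ≥0) (hL : 0 ∈ L) :
    ∃ (n : ℕ) (t : Fin (n + 1) → ℝ≥0), Monotone t ∧ t 0 = 0 ∧ ∀ a ∈ L, ∃ k, t k = a := by
  have hc : L.card = (L.card - 1) + 1 := by have := Finset.card_pos.mpr ⟨0, hL⟩; omega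
  have hr : ∀ a ∈ L, ∃ k, L.orderEmbOfFin hc k = a := fun a ha => by
    have := Finset.range_orderEmbOfFin L hc
    have h2 : a ∈ Set.range (L.orderEmbOfFin hc) := by rw [this]; exact ha
    exact h2
  refine ⟨_, L.orderEmbOfFin hc, (L.orderEmbOfFin hc).monotone, ?_, hr⟩
  obtain ⟨k, hk⟩ := hr 0 hL
  exact le_antisymm (hk ▸ (L.orderEmbOfFin hc).monotone (Fin.zero_le k)) zero_le

lemma IsBrownianLaw.ae_zero {x : E d} {μ : Measure (PathSpace d)} (h : IsBrownianLaw x μ) :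
    ∀ᵐ w ∂μ, w 0 = x := by
  have := h.1
  have hm : MeasurableSet {w : PathSpace d | w 0 = x} :=
    measurableSet_eq_fun (measurable_eval 0) measurable_const
  exact (prob_compl_eq_zero_iff hm).mpr h.2.1

/-- The law of Brownian motion is determined by its starting point. -/
lemma IsBrownianLaw.unique {x : E d} {μ ν : Measure (PathSpace d)} (hμ : IsBrownianLaw x μ)
    (hν : IsBrownianLaw x ν) : μ = ν := by
  have := hμ.1
  have := hν.1
  set ev : PathSpace d → ℝ≥0 → E d := fun w => w
  have hev : Measurable ev := measurable_pi_lambda _ fun t => measurable_eval t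
  have hfin : ∀ I : Finset ℝ≥0, (μ.map ev).map I.restrict = (ν.map ev).map I.restrict := by
    intro I
    obtain ⟨n, t, ht, ht0, hk⟩ := exists_grid (insert 0 I) (Finset.mem_insert_self _ _)
    choose! k hk using hk
    let G : (Fin n × Fin d → ℝ) → I → E d := fun z i => x + WithLp.toLp 2 fun c =>
      ∑ j : Fin n, if 0 ≤ j.castSucc ∧ j.castSucc < k i then z (j, c) else 0
    have hG : Measurable G := by
      refine measurable_pi_lambda _ fun i => Measurable.const_add ?_ _
      refine (WithLp.measurable_toLp 2 _).comp (measurable_pi_lambda _ fun c => ?_)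
      refine Finset.measurable_sum _ fun j _ => ?_
      split_ifs <;> fun_prop
    have key : ∀ ρ : Measure (PathSpace d), IsBrownianLaw x ρ →
        (ρ.map ev).map I.restrict = (ρ.map (increments t)).map G := by
      intro ρ hρ
      rw [Measure.map_map (Finset.measurable_restrict _) hev,
        Measure.map_map hG (measurable_increments t)]
      refine Measure.map_congr ?_
      filter_upwards [hρ.ae_zero] with w hw
      ext i c
      have := sub_eq_sum_increments t w c (Fin.zero_le (k i))
      rw [hk i (Finset.mem_insert_of_mem i.2), ht0, hw] at this
      simp only [Function.comp, G, ev, Finset.restrict]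
      rw [PiLp.add_apply]
      simp only [← this]
      ring
    rw [key μ hμ, key ν hν, hμ.2.2 n t ht, hν.2.2 n t ht]
  have hmap : μ.map ev = ν.map ev :=
    IsProjectiveLimit.unique (P := fun I => (ν.map ev).map I.restrict) hfin fun I => rfl
  ext s hs
  have hs' : MeasurableSet[MeasurableSpace.comap ev MeasurableSpace.pi] s := by
    have := pathSpace_measurableSpace_eq (d := d)
    rw [← this]; exact hs
  obtain ⟨s', hs', rfl⟩ := hs'
  rw [← Measure.map_apply hev hs', ← Measure.map_apply hev hs', hmap]

/-- A path transformation that shifts time in the increments preserves Brownian motion. -/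
lemma IsBrownianLaw.map_of_sub {x y : E d} {μ : Measure (PathSpace d)} (hμ : IsBrownianLaw x μ)
    {Φ : PathSpace d → PathSpace d} (hΦ : Measurable Φ) (s : ℝ≥0)
    (hsub : ∀ w a b, Φ w b - Φ w a = w (s + b) - w (s + a)) (h0 : ∀ᵐ w ∂μ, Φ w 0 = y) :
    IsBrownianLaw y (μ.map Φ) := by
  have := hμ.1
  have hp : IsProbabilityMeasure (μ.map Φ) := Measure.isProbabilityMeasure_map hΦ.aemeasurable
  refine ⟨hp, ?_, fun n t ht => ?_⟩
  · rw [Measure.map_apply hΦ (measurableSet_eq_fun (measurable_eval 0) measurable_const)]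
    exact (prob_compl_eq_zero_iff (hΦ (measurableSet_eq_fun (measurable_eval 0)
      measurable_const))).mp h0
  · rw [Measure.map_map (measurable_increments t) hΦ]
    have : increments t ∘ Φ = increments fun k => s + t k := by
      funext w p
      have := congrArg (fun v : E d => v p.2) (hsub w (t p.1.castSucc) (t p.1.succ))
      simpa [increments] using this
    rw [this, hμ.2.2 n (fun k => s + t k) fun a b hab => add_le_add_right (ht hab) s]
    simp only [add_tsub_add_eq_tsub_left]

/-- The path frozen from time `s` on. -/
def stopAt (s : ℝ≥0) (w : PathSpace d) : PathSpace d := w.comp ⟨fun u => min u s, by fun_prop⟩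

/-- The path after time `s`. -/
def shiftBy (s : ℝ≥0) (w : PathSpace d) : PathSpace d := w.comp ⟨fun u => s + u, by fun_prop⟩

/-- The path translated by a vector. -/
def translatePath (p : E d × PathSpace d) : PathSpace d := ContinuousMap.const ℝ≥0 p.1 + p.2

@[simp] lemma stopAt_apply (s u : ℝ≥0) (w : PathSpace d) : stopAt s w u = w (min u s) := rfl

@[simp] lemma shiftBy_apply (s u : ℝ≥0) (w : PathSpace d) : shiftBy s w u = w (s + u) := rfl

@[simp] lemma translatePath_apply (x : E d) (w : PathSpace d) (u : ℝ≥0) :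
    translatePath (x, w) u = x + w u := rfl

@[fun_prop]
lemma continuous_stopAt (s : ℝ≥0) : Continuous (stopAt (d := d) s) :=
  ContinuousMap.continuous_precomp _

@[fun_prop]
lemma continuous_shiftBy (s : ℝ≥0) : Continuous (shiftBy (d := d) s) :=
  ContinuousMap.continuous_precomp _

@[fun_prop]
lemma continuous_translatePath : Continuous (translatePath (d := d)) :=
  (ContinuousMap.continuous_const'.comp continuous_fst).add continuous_snd

@[fun_prop]
lemma measurable_translatePath : Measurable (translatePath (d := d)) :=
  continuous_translatePath.measurable

lemma measurable_translatePath_left (x : E d) : Measurable fun b => translatePath (x, b) :=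
  measurable_translatePath.comp (by fun_prop)

lemma IsBrownianLaw.eq_map_translatePath {x : E d} {μ ν : Measure (PathSpace d)}
    (hμ : IsBrownianLaw x μ) (hν : IsBrownianLaw 0 ν) :
    μ = ν.map fun b => translatePath (x, b) := by
  refine hμ.unique (hν.map_of_sub (measurable_translatePath_left x) 0 (fun w a b => ?_) ?_)
  · simp
  · filter_upwards [hν.ae_zero] with w hw
    simp [hw]

lemma iIndepFun_increments {x : E d} {μ : Measure (PathSpace d)} (hμ : IsBrownianLaw x μ)
    {n : ℕ} {t : Fin (n + 1) → ℝ≥0} (ht : Monotone t) :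
    iIndepFun (fun (p : Fin n × Fin d) (w : PathSpace d) => increments t w p) μ := by
  have := hμ.1
  have hm : ∀ p, Measurable fun w : PathSpace d => increments t w p := fun p =>
    (measurable_pi_apply p).comp (measurable_increments t)
  rw [iIndepFun_iff_map_fun_eq_pi_map fun p => (hm p).aemeasurable]
  refine (hμ.2.2 n t ht).trans (congrArg Measure.pi (funext fun p => ?_))
  have : (fun w : PathSpace d => increments t w p) = (fun z => z p) ∘ increments t := rfl
  rw [this, ← Measure.map_map (measurable_pi_apply p) (measurable_increments t), hμ.2.2 n t ht]
  exact ((measurePreserving_eval (fun p : Fin n × Fin d =>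
    gaussianReal 0 (t p.1.succ - t p.1.castSucc)) p).map_eq).symm

/-- The past and the future increments of Brownian motion are independent. -/
lemma indepFun_past_future {x : E d} {μ : Measure (PathSpace d)} (hμ : IsBrownianLaw x μ)
    (s : ℝ≥0) :
    IndepFun (fun w => translatePath (-w 0, stopAt s w))
      (fun w => translatePath (-w s, shiftBy s w)) μ := by
  have := hμ.1
  have hfin : ∀ I J : Finset ℝ≥0,
      IndepFun (fun (w : PathSpace d) (i : I) => translatePath (-w 0, stopAt s w) i)
        (fun (w : PathSpace d) (j : J) => translatePath (-w s, shiftBy s w) j) μ := by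
    intro I J
    obtain ⟨n, t, ht, ht0, hk⟩ := exists_grid
      (insert 0 (insert s (I.image (min · s) ∪ J.image (s + ·)))) (Finset.mem_insert_self _ _)
    obtain ⟨k₀, hk₀⟩ := hk s (by simp)
    have hI : ∀ i ∈ I, ∃ k ≤ k₀, t k = min i s := by
      intro i hi
      obtain ⟨k, hk⟩ := hk (min i s) (by
        simp only [Finset.mem_insert, Finset.mem_union, Finset.mem_image]
        exact .inr (.inr (.inl ⟨i, hi, rfl⟩)))
      rcases le_total k k₀ with h | h
      · exact ⟨k, h, hk⟩
      · exact ⟨k₀, le_rfl, le_antisymm (hk ▸ ht h) (hk₀ ▸ min_le_right _ _)⟩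
    have hJ : ∀ j ∈ J, ∃ k, k₀ ≤ k ∧ t k = s + j := by
      intro j hj
      obtain ⟨k, hk⟩ := hk (s + j) (by
        simp only [Finset.mem_insert, Finset.mem_union, Finset.mem_image]
        exact .inr (.inr (.inr ⟨j, hj, rfl⟩)))
      rcases le_total k₀ k with h | h
      · exact ⟨k, h, hk⟩
      · exact ⟨k₀, le_rfl, le_antisymm (hk₀ ▸ le_self_add) (hk ▸ ht h)⟩
    let m : Fin n × Fin d → MeasurableSpace (PathSpace d) := fun p =>
      MeasurableSpace.comap (fun w => increments t w p) inferInstance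
    have hind : iIndep m μ := (iIndepFun_iff_iIndep ..).mp (iIndepFun_increments hμ ht)
    have hm : ∀ p, m p ≤ (inferInstance : MeasurableSpace (PathSpace d)) := fun p =>
      ((measurable_pi_apply p).comp (measurable_increments t)).comap_le
    let S : Set (Fin n × Fin d) := {p | p.1.castSucc < k₀}
    let T : Set (Fin n × Fin d) := {p | k₀ ≤ p.1.castSucc}
    have hST : Disjoint S T := Set.disjoint_left.mpr fun p h1 h2 =>
      (show p.1.castSucc < k₀ from h1).not_ge h2
    have hi := indep_iSup_of_disjoint hm hind hST
    have hmeas : ∀ (R : Set (Fin n × Fin d)) (l k : Fin (n + 1)), l ≤ k →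
        (∀ p : Fin n × Fin d, l ≤ p.1.castSucc → p.1.castSucc < k → p ∈ R) →
        Measurable[⨆ p ∈ R, m p] fun w : PathSpace d => w (t k) - w (t l) := by
      intro R l k hlk hR
      have h : Measurable[⨆ p ∈ R, m p] fun w : PathSpace d =>
          WithLp.toLp 2 fun c : Fin d => w (t k) c - w (t l) c := by
        refine (WithLp.measurable_toLp 2 _).comp ?_
        refine @measurable_pi_lambda _ _ _ (_) _ _ fun c => ?_
        simp_rw [sub_eq_sum_increments t _ c hlk]
        refine @Finset.measurable_sum _ _ _ _ _ _ (_) _ _ fun j _ => ?_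
        split_ifs with hj
        · exact (comap_measurable fun w : PathSpace d => increments t w (j, c)).mono
            (le_iSup₂_of_le (j, c) (hR (j, c) hj.1 hj.2) le_rfl) le_rfl
        · exact @measurable_const _ _ _ (_) _
      exact h
    rw [IndepFun_iff_Indep]
    refine indep_of_indep_of_le_left (indep_of_indep_of_le_right hi ?_) ?_
    · refine Measurable.comap_le (@measurable_pi_lambda _ _ _ (_) _ _ fun j => ?_)
      obtain ⟨k, hkk, hk⟩ := hJ j j.2
      have := hmeas T k₀ k hkk fun p h _ => h
      rw [hk, hk₀] at this
      convert this using 2 with w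
      simp [sub_eq_neg_add]
    · refine Measurable.comap_le (@measurable_pi_lambda _ _ _ (_) _ _ fun i => ?_)
      obtain ⟨k, hkk, hk⟩ := hI i i.2
      have := hmeas S 0 k (Fin.zero_le k) fun p _ h => h.trans_le hkk
      rw [hk, ht0] at this
      convert this using 2 with w
      simp [sub_eq_neg_add]
  have hpast : Continuous fun w : PathSpace d => translatePath (-w 0, stopAt s w) := by fun_prop
  have hfut : Continuous fun w : PathSpace d => translatePath (-w s, shiftBy s w) := by fun_prop
  have h := IndepFun.process_indepFun_process
    (X := fun (i : ℝ≥0) (w : PathSpace d) => translatePath (-w 0, stopAt s w) i)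
    (Y := fun (i : ℝ≥0) (w : PathSpace d) => translatePath (-w s, shiftBy s w) i)
    (fun i => (measurable_eval i).comp hpast.measurable)
    (fun i => (measurable_eval i).comp hfut.measurable) hfin
  rw [IndepFun_iff_Indep] at h ⊢
  convert h using 1
  all_goals
    rw [pathSpace_measurableSpace_eq, MeasurableSpace.comap_comp]
    rfl

/-- The simple Markov property at time `s`, for events `A` that only depend on the path up to
time `s`. -/
lemma IsWiener.markov {W : E d → Measure (PathSpace d)} (hW : IsWiener W) (x : E d) (s : ℝ≥0)
    {A C : Set (PathSpace d)} (hA : MeasurableSet A) (hAs : ∀ w, stopAt s w ∈ A ↔ w ∈ A)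
    (hC : MeasurableSet C) :
    W x (A ∩ shiftBy s ⁻¹' C) = ∫⁻ w in A, W (w s) C ∂(W x) := by
  have := (hW x).1
  have := (hW 0).1
  set future : PathSpace d → PathSpace d := fun w => translatePath (-w s, shiftBy s w) with hfut
  have hfutm : Measurable future := Continuous.measurable (by fun_prop)
  have hpastm : Measurable (stopAt (d := d) s) := (continuous_stopAt s).measurable
  have hlaw : (W x).map future = W 0 := by
    refine IsBrownianLaw.unique ((hW.isBrownianLaw x).map_of_sub hfutm s (fun w a b => ?_) ?_)
      (hW.isBrownianLaw 0)
    · simp [future]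
    · exact ae_of_all _ fun w => by simp [future]
  have hind : IndepFun (stopAt s) future (W x) := by
    refine ((indepFun_past_future (hW.isBrownianLaw x) s).comp (measurable_translatePath_left x)
      measurable_id).congr ?_ .rfl
    filter_upwards [(hW.isBrownianLaw x).ae_zero] with w hw
    ext u : 1
    simp [hw]
  have hprod : (W x).map (fun w => (stopAt s w, future w)) = ((W x).map (stopAt s)).prod (W 0) := by
    rw [(indepFun_iff_map_prod_eq_prod_map_map hpastm.aemeasurable hfutm.aemeasurable).mp hind, hlaw]
  let D : Set (PathSpace d × PathSpace d) := {q | q.1 ∈ A ∧ translatePath (q.1 s, q.2) ∈ C}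
  have hD : MeasurableSet D :=
    (measurable_fst hA).inter (Continuous.measurable (by fun_prop) hC)
  have hpre : A ∩ shiftBy s ⁻¹' C = (fun w => (stopAt s w, future w)) ⁻¹' D := by
    ext w
    have : translatePath (w s, future w) = shiftBy s w := by
      ext u : 1
      simp [future]
    simp [D, hAs, this]
  have hpm : Measurable fun w => (stopAt s w, future w) := hpastm.prodMk hfutm
  have hslice : ∀ v, W 0 (Prod.mk v ⁻¹' D) = A.indicator (fun v => W (v s) C) v := by
    intro v
    by_cases hv : v ∈ A
    · rw [Set.indicator_of_mem hv,
        (hW.isBrownianLaw (v s)).eq_map_translatePath (hW.isBrownianLaw 0),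
        Measure.map_apply (measurable_translatePath_left _) hC]
      congr 1
      ext b
      simp [D, hv]
    · rw [Set.indicator_of_notMem hv]
      convert measure_empty (μ := W 0)
      ext b
      simp [D, hv]
  rw [hpre, ← Measure.map_apply hpm hD, hprod, Measure.prod_apply hD,
    lintegral_map (measurable_measure_prodMk_left hD) hpastm, ← lintegral_indicator hA]
  refine lintegral_congr fun w => ?_
  rw [hslice]
  by_cases hw : w ∈ A
  · rw [Set.indicator_of_mem hw, Set.indicator_of_mem ((hAs w).mpr hw)]
    simp
  · rw [Set.indicator_of_notMem hw, Set.indicator_of_notMem fun h => hw ((hAs w).mp h)]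

lemma IsWiener.measurable_apply {W : E d → Measure (PathSpace d)} (hW : IsWiener W)
    {C : Set (PathSpace d)} (hC : MeasurableSet C) : Measurable fun y => W y C := by
  have := (hW 0).1
  have h := measurable_measure_prodMk_left (ν := W 0) (measurable_translatePath hC)
  convert h using 2 with y
  rw [(hW.isBrownianLaw y).eq_map_translatePath (hW.isBrownianLaw 0),
    Measure.map_apply (measurable_translatePath_left _) hC]
  rfl

/-- The paths that stay in `U` up to time `t`, included. -/
def stayIn (U : Set (E d)) (t : ℝ≥0) : Set (PathSpace d) := {w | ∀ u ≤ t, w u ∈ U}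

lemma stayIn_anti (U : Set (E d)) {s t : ℝ≥0} (hst : s ≤ t) : stayIn U t ⊆ stayIn U s :=
  fun _ hw u hu => hw u (hu.trans hst)

lemma stopAt_mem_stayIn {U : Set (E d)} {s t : ℝ≥0} (hst : t ≤ s) (w : PathSpace d) :
    stopAt s w ∈ stayIn U t ↔ w ∈ stayIn U t := by
  refine forall₂_congr fun u hu => ?_
  simp [min_eq_left (hu.trans hst)]

lemma isOpen_stayIn {U : Set (E d)} (hU : IsOpen U) (t : ℝ≥0) : IsOpen (stayIn U t) := by
  have h := ContinuousMap.isOpen_setOfPred_mapsTo (isCompact_Icc (a := (0 : ℝ≥0)) (b := t)) hU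
  convert h using 1
  ext w
  simp [stayIn, Set.MapsTo]

lemma isClosed_stayIn {F : Set (E d)} (hF : IsClosed F) (t : ℝ≥0) : IsClosed (stayIn F t) := by
  have : stayIn F t = ⋂ u ≤ t, {w | w u ∈ F} := by ext; simp [stayIn]
  rw [this]
  exact isClosed_biInter fun u _ => hF.preimage (continuous_eval u)

lemma exists_gt_mem_stayIn {U : Set (E d)} (hU : IsOpen U) {t : ℝ≥0} {w : PathSpace d}
    (hw : w ∈ stayIn U t) : ∃ t' > t, w ∈ stayIn U t' := by
  have hn : w ⁻¹' U ∈ 𝓝[≥] t :=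
    mem_nhdsWithin_of_mem_nhds ((hU.preimage w.continuous).mem_nhds (hw t le_rfl))
  obtain ⟨b, hb, hbU⟩ := mem_nhdsGE_iff_exists_Ico_subset.mp hn
  obtain ⟨c, hc, hcb⟩ := exists_between (Set.mem_Ioi.mp hb)
  refine ⟨c, hc, fun u hu => ?_⟩
  rcases le_total u t with h | h
  · exact hw u h
  · exact hbU ⟨h, hu.trans_lt hcb⟩

lemma lt_exitTime_iff {U : Set (E d)} (hU : IsOpen U) {w : PathSpace d} (h0 : w 0 ∈ U)
    (t : ℝ≥0) : (t : ℝ≥0∞) < exitTime U w ↔ w ∈ stayIn U t := by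
  constructor
  · intro h u hu
    by_contra hwu
    have hu0 : 0 < u := pos_iff_ne_zero.mpr fun h => hwu (h ▸ h0)
    have : exitTime U w ≤ u := sInf_le ⟨u, ⟨hu0, hwu⟩, rfl⟩
    exact (h.trans_le this).not_ge (by exact_mod_cast hu)
  · intro h
    obtain ⟨t', ht', hw⟩ := exists_gt_mem_stayIn hU h
    refine lt_of_lt_of_le (ENNReal.coe_lt_coe.mpr ht') (le_sInf ?_)
    rintro _ ⟨u, ⟨-, hu⟩, rfl⟩
    exact ENNReal.coe_le_coe.mpr (le_of_not_ge fun h => hu (hw u h))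

/-- The paths that leave the open set `U` exactly at time `t`. -/
def leaveAt (U : Set (E d)) (t : ℝ≥0) : Set (PathSpace d) := {w | (∀ u < t, w u ∈ U) ∧ w t ∉ U}

lemma measurableSet_leaveAt {U : Set (E d)} (hU : IsOpen U) (t : ℝ≥0) :
    MeasurableSet (leaveAt U t) := by
  obtain ⟨D, hDc, hD⟩ := TopologicalSpace.exists_countable_dense ℝ≥0
  have : leaveAt U t = (⋂ q ∈ D ∩ Set.Iio t, stayIn U q) ∩ {w | w t ∈ Uᶜ} := by
    ext w
    simp only [leaveAt, stayIn, Set.mem_ofPred_eq, Set.mem_inter_iff, Set.mem_iInter,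
      Set.mem_compl_iff, Set.mem_Iio]
    refine and_congr_left fun _ => ⟨fun h q hq u hu => h u (hu.trans_lt hq.2), fun h u hu => ?_⟩
    obtain ⟨q, hq, huq, hqt⟩ := hD.exists_between hu
    exact h q ⟨hq, hqt⟩ u huq.le
  rw [this]
  exact (MeasurableSet.biInter (hDc.mono Set.inter_subset_left) fun q _ =>
    (isOpen_stayIn hU q).measurableSet).inter (measurable_eval t hU.measurableSet.compl)

lemma leaveAt_disjoint (U : Set (E d)) {s t : ℝ≥0} (hst : s ≠ t) :
    Disjoint (leaveAt U s) (leaveAt U t) := by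
  refine Set.disjoint_left.mpr fun w hs ht => ?_
  rcases hst.lt_or_gt with h | h
  · exact hs.2 (ht.1 s h)
  · exact ht.2 (hs.1 t h)

lemma pi_absolutelyContinuous {ι : Type*} [Fintype ι] {μ ν : ι → Measure ℝ}
    [∀ i, IsProbabilityMeasure (μ i)] [∀ i, IsProbabilityMeasure (ν i)] (h : ∀ i, μ i ≪ ν i) :
    Measure.pi μ ≪ Measure.pi ν := by
  let f : ι → ℝ → ℝ≥0∞ := fun i => (μ i).rnDeriv (ν i)
  have hf : ∀ i, Measurable (f i) := fun i => Measure.measurable_rnDeriv _ _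
  have : Measure.pi μ = (Measure.pi ν).withDensity fun z => ∏ i, f i (z i) := by
    refine Measure.pi_eq fun s hs => ?_
    have hg : ∀ i, Measurable ((s i).indicator (f i)) := fun i => (hf i).indicator (hs i)
    rw [withDensity_apply _ (MeasurableSet.univ_pi hs), ← lintegral_indicator
      (MeasurableSet.univ_pi hs)]
    have hind := iIndepFun_pi (μ := ν) (X := fun i => (s i).indicator (f i))
      fun i => (hg i).aemeasurable
    calc _ = ∫⁻ z, ∏ i, (s i).indicator (f i) (z i) ∂(Measure.pi ν) := by
          refine lintegral_congr fun z => ?_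
          by_cases hz : z ∈ Set.univ.pi s
          · rw [Set.indicator_of_mem hz]
            exact Finset.prod_congr rfl fun i _ =>
              (Set.indicator_of_mem (hz i (Set.mem_univ i)) _).symm
          · rw [Set.indicator_of_notMem hz]
            obtain ⟨i, hi⟩ : ∃ i, z i ∉ s i := by simpa using hz
            exact (Finset.prod_eq_zero (Finset.mem_univ i) (Set.indicator_of_notMem hi _)).symm
      _ = ∏ i, ∫⁻ z, (s i).indicator (f i) (z i) ∂(Measure.pi ν) := by
          exact lintegral_prod_eq_prod_lintegral_of_indepFun Finset.univ _ hind
            fun i => (hg i).comp (measurable_pi_apply i)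
      _ = ∏ i, μ i (s i) := by
          refine Finset.prod_congr rfl fun i _ => ?_
          rw [(measurePreserving_eval ν i).lintegral_comp (hg i), lintegral_indicator (hs i),
            ← withDensity_apply _ (hs i), Measure.withDensity_rnDeriv_eq _ _ (h i)]
  rw [this]
  exact withDensity_absolutelyContinuous _ _

lemma IsBrownianLaw.map_eval {x : E d} {μ : Measure (PathSpace d)} (hμ : IsBrownianLaw x μ)
    (s : ℝ≥0) :
    μ.map (fun w => w s) = (Measure.pi fun _ : Fin 1 × Fin d => gaussianReal 0 s).map
      fun z => x + WithLp.toLp 2 fun c => z (0, c) := by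
  let t : Fin 2 → ℝ≥0 := ![0, s]
  have ht : Monotone t := by
    rw [Fin.monotone_iff_le_succ]
    simp [t]
  have h := hμ.2.2 1 t ht
  have hp : (fun p : Fin 1 × Fin d => gaussianReal 0 (t p.1.succ - t p.1.castSucc))
      = fun _ => gaussianReal 0 s := by
    funext p
    simp [t, Fin.fin_one_eq_zero]
  have hG : Measurable fun z : Fin 1 × Fin d → ℝ => x + WithLp.toLp 2 fun c => z (0, c) := by
    fun_prop
  rw [hp] at h
  rw [← h, Measure.map_map hG (measurable_increments t)]
  refine Measure.map_congr ?_
  filter_upwards [hμ.ae_zero] with w hw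
  ext c
  simp [increments, t, hw]

/-- The laws of Brownian motion at two positive times are mutually absolutely continuous. -/
lemma IsBrownianLaw.map_eval_absolutelyContinuous {x : E d} {μ : Measure (PathSpace d)}
    (hμ : IsBrownianLaw x μ) {s t : ℝ≥0} (hs : s ≠ 0) (ht : t ≠ 0) :
    μ.map (fun w => w s) ≪ μ.map (fun w => w t) := by
  rw [hμ.map_eval, hμ.map_eval]
  exact (pi_absolutelyContinuous fun _ => (gaussianReal_absolutelyContinuous 0 hs).trans
    (gaussianReal_absolutelyContinuous' 0 ht)).map (by fun_prop)

/-- Brownian motion does not leave an open set at a deterministic time. -/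
lemma IsWiener.leaveAt_eq_zero {W : E d → Measure (PathSpace d)} (hW : IsWiener W)
    {U : Set (E d)} (hU : IsOpen U) (x : E d) {t : ℝ≥0} (ht : 0 < t) : W x (leaveAt U t) = 0 := by
  have := (hW x).1
  have := (hW 0).1
  set m := (W x).map (fun w => w 1)
  set ν := (m.prod (W 0)).map translatePath with hν
  have hcount : {r : ℝ≥0 | 0 < ν (leaveAt U r)}.Countable :=
    Measure.countable_meas_pos_of_disjoint_iUnion (fun r => measurableSet_leaveAt hU r)
      fun r s hrs => leaveAt_disjoint U hrs
  obtain ⟨r, hr0, hrt, hr⟩ : ∃ r : ℝ≥0, 0 < r ∧ r < t ∧ ν (leaveAt U r) = 0 := by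
    by_contra! hne
    have hsub : Set.Ioo (0 : ℝ) t ⊆ (↑) '' {r : ℝ≥0 | 0 < ν (leaveAt U r)} := fun r hr =>
      ⟨⟨r, hr.1.le⟩, pos_iff_ne_zero.mpr (hne _ hr.1 hr.2), rfl⟩
    have := (hcount.image ((↑) : ℝ≥0 → ℝ)).mono hsub
    rw [← Cardinal.le_aleph0_iff_set_countable, Cardinal.mk_Ioo_real (by exact_mod_cast ht)] at this
    exact this.not_gt Cardinal.aleph0_lt_continuum
  have hT := measurableSet_leaveAt hU r
  rw [hν, Measure.map_apply measurable_translatePath hT,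
    Measure.measure_prod_null (measurable_translatePath hT)] at hr
  have hm : ∀ᵐ y ∂m, W y (leaveAt U r) = 0 := by
    filter_upwards [hr] with y hy
    rw [(hW.isBrownianLaw y).eq_map_translatePath (hW.isBrownianLaw 0),
      Measure.map_apply (measurable_translatePath_left _) hT]
    exact hy
  have hs : ∀ᵐ w ∂(W x), W (w (t - r)) (leaveAt U r) = 0 :=
    ae_of_ae_map (measurable_eval _).aemeasurable
      (((hW.isBrownianLaw x).map_eval_absolutelyContinuous
        (tsub_pos_of_lt hrt).ne' one_ne_zero).ae_le hm)
  have hle : leaveAt U t ⊆ Set.univ ∩ shiftBy (t - r) ⁻¹' leaveAt U r := by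
    refine fun w hw => ⟨trivial, fun u hu => hw.1 _ ?_, ?_⟩
    · calc t - r + u < t - r + r := by gcongr
        _ = t := tsub_add_cancel_of_le hrt.le
    · rw [shiftBy_apply, tsub_add_cancel_of_le hrt.le]
      exact hw.2
  refine measure_mono_null hle ?_
  rw [hW.markov x _ MeasurableSet.univ (fun _ => Iff.rfl) hT, setLIntegral_univ,
    lintegral_congr_ae hs, lintegral_zero]

lemma exists_mem_leaveAt {U : Set (E d)} (hU : IsOpen U) {w : PathSpace d} {a : ℝ≥0}
    (hw : w a ∉ U) : ∃ τ ≤ a, w ∈ leaveAt U τ := by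
  have hne : (w ⁻¹' Uᶜ).Nonempty := ⟨a, hw⟩
  refine ⟨sInf (w ⁻¹' Uᶜ), csInf_le' hw, fun u hu => ?_, ?_⟩
  · by_contra h
    exact (csInf_le' (s := w ⁻¹' Uᶜ) h).not_gt hu
  · exact (hU.isClosed_compl.preimage w.continuous).csInf_mem hne (OrderBot.bddBelow _)

lemma mem_frontier_of_mem_leaveAt {U : Set (E d)} (hU : IsOpen U) {w : PathSpace d} {τ : ℝ≥0}
    (h0 : w 0 ∈ U) (hw : w ∈ leaveAt U τ) : w τ ∈ frontier U := by
  rw [hU.frontier_eq]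
  refine ⟨?_, hw.2⟩
  have hτ : 0 < τ := pos_iff_ne_zero.mpr fun h => hw.2 (h ▸ h0)
  have hne : (𝓝[<] τ).NeBot := nhdsLT_neBot_of_exists_lt ⟨0, hτ⟩
  refine mem_closure_of_tendsto (b := 𝓝[<] τ) (w.continuous.continuousAt.mono_left inf_le_left) ?_
  filter_upwards [self_mem_nhdsWithin] with u hu
  exact hw.1 u hu

lemma IsWiener.tendsto_measure_stayIn_closure {W : E d → Measure (PathSpace d)} (hW : IsWiener W)
    {U : Set (E d)} (hreg : IsCoRegular W U) {y : E d} (hy : y ∈ frontier U) {η : ℝ≥0}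
    (hη : 0 < η) : Tendsto (fun z => W z (stayIn (closure U) η)) (𝓝 y) (𝓝 0) := by
  have := (hW 0).1
  set C := stayIn (closure U) η
  have hC : IsClosed C := isClosed_stayIn isClosed_closure η
  have hrep : ∀ z, W z C = ∫⁻ b, C.indicator 1 (translatePath (z, b)) ∂(W 0) := by
    intro z
    rw [(hW.isBrownianLaw z).eq_map_translatePath (hW.isBrownianLaw 0),
      ← lintegral_indicator_one hC.measurableSet,
      lintegral_map (measurable_one.indicator hC.measurableSet) (measurable_translatePath_left z)]
  have hzero : W y C = 0 := by
    refine measure_mono_null (fun w hw => ?_) (hreg y hy)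
    refine lt_of_lt_of_le (ENNReal.coe_pos.mpr hη) (le_sInf ?_)
    rintro _ ⟨u, ⟨-, hu⟩, rfl⟩
    exact ENNReal.coe_le_coe.mpr (le_of_not_ge fun h => hu (hw u h))
  have hae : ∀ᵐ b ∂(W 0), translatePath (y, b) ∉ C := by
    rw [(hW.isBrownianLaw y).eq_map_translatePath (hW.isBrownianLaw 0),
      Measure.map_apply (measurable_translatePath_left y) hC.measurableSet] at hzero
    exact measure_eq_zero_iff_ae_notMem.mp hzero
  simp_rw [hrep]
  rw [← lintegral_zero (μ := W 0)]
  refine tendsto_lintegral_filter_of_dominated_convergence (fun _ => 1)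
    (.of_forall fun z => (measurable_one.indicator hC.measurableSet).comp
      (measurable_translatePath_left z))
    (.of_forall fun z => ae_of_all _ fun b => Set.indicator_le_self' (by simp) _) (by simp) ?_
  filter_upwards [hae] with b hb
  have hc : Continuous fun z => translatePath (z, b) := by fun_prop
  refine tendsto_const_nhds.congr' ?_
  filter_upwards [hc.continuousAt.eventually (hC.isOpen_compl.mem_nhds hb)] with z hz
  exact (Set.indicator_of_notMem hz _).symm

/-- The paths that leave `U` for the first time in the `k`-th time interval of length `δ`. -/
def leaveIn (U : Set (E d)) (δ : ℝ≥0) (k : ℕ) : Set (PathSpace d) :=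
  stayIn U (k * δ) \ stayIn U ((k + 1) * δ)

lemma measurableSet_leaveIn {U : Set (E d)} (hU : IsOpen U) (δ : ℝ≥0) (k : ℕ) :
    MeasurableSet (leaveIn U δ k) :=
  (isOpen_stayIn hU _).measurableSet.diff (isOpen_stayIn hU _).measurableSet

lemma leaveIn_unique {U : Set (E d)} {δ : ℝ≥0} {j k : ℕ} {w : PathSpace d}
    (hj : w ∈ leaveIn U δ j) (hk : w ∈ leaveIn U δ k) : j = k := by
  have h : ∀ {j k : ℕ}, w ∈ leaveIn U δ j → w ∈ leaveIn U δ k → ¬ j < k := fun hj hk hjk =>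
    hj.2 (stayIn_anti U (mul_le_mul_left (by exact_mod_cast hjk) δ) hk.1)
  exact le_antisymm (not_lt.mp (h hk hj)) (not_lt.mp (h hj hk))

/-- The sum over `k` of `g` at the end of the `k`-th time interval, restricted to the paths that
leave `U` for the first time in this interval. -/
def gridExit (U : Set (E d)) (g : E d → ℝ≥0∞) (δ : ℝ≥0) (w : PathSpace d) : ℝ≥0∞ :=
  ∑' k : ℕ, (leaveIn U δ k).indicator (fun w => g (w ((k + 1) * δ))) w

lemma gridExit_eq {U : Set (E d)} (g : E d → ℝ≥0∞) {δ : ℝ≥0} {k : ℕ} {w : PathSpace d}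
    (hk : w ∈ leaveIn U δ k) : gridExit U g δ w = g (w ((k + 1) * δ)) := by
  rw [gridExit, tsum_eq_single k, Set.indicator_of_mem hk]
  exact fun j hj => Set.indicator_of_notMem (fun h => hj (leaveIn_unique h hk)) _

lemma gridExit_eq_zero {U : Set (E d)} (g : E d → ℝ≥0∞) {δ : ℝ≥0} {w : PathSpace d}
    (hk : ∀ k, w ∉ leaveIn U δ k) : gridExit U g δ w = 0 := by
  simp [gridExit, hk]

lemma tendsto_gridExit {U : Set (E d)} (hU : IsOpen U) {g : E d → ℝ≥0∞}
    (hg : ∀ y ∈ frontier U, Tendsto g (𝓝 y) (𝓝 0)) {δ : ℕ → ℝ≥0}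
    (hδ : Tendsto δ atTop (𝓝 0)) (w : PathSpace d) :
    Tendsto (fun n => gridExit U g (δ n) w) atTop (𝓝 0) := by
  by_cases hw : w 0 ∈ U ∧ ∃ a, w a ∉ U
  · obtain ⟨h0, a, ha⟩ := hw
    obtain ⟨τ, -, hτ⟩ := exists_mem_leaveAt hU ha
    rw [ENNReal.tendsto_nhds_zero]
    intro ε hε
    have hn : ∀ᶠ u in 𝓝 τ, g (w u) ≤ ε :=
      w.continuous.continuousAt.eventually
        ((ENNReal.tendsto_nhds_zero.mp (hg _ (mem_frontier_of_mem_leaveAt hU h0 hτ))) ε hε)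
    obtain ⟨ρ, hρ, hball⟩ := Metric.eventually_nhds_iff.mp hn
    filter_upwards [hδ.eventually (Metric.ball_mem_nhds 0 hρ)] with n hδn
    by_cases hk : ∃ k, w ∈ leaveIn U (δ n) k
    · obtain ⟨k, hk⟩ := hk
      rw [gridExit_eq g hk]
      refine hball ?_
      have h1 : (k : ℝ≥0) * δ n < τ := by
        by_contra! h
        exact hτ.2 (hk.1 τ h)
      have h2 : τ ≤ (k + 1) * δ n := by
        by_contra! h
        exact hk.2 fun u hu => hτ.1 u (hu.trans_lt h)
      have h1' : (k : ℝ) * δ n < τ := by exact_mod_cast h1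
      have h2' : (τ : ℝ) ≤ (k + 1) * δ n := by exact_mod_cast h2
      have h3 : (δ n : ℝ) < ρ := by
        have : dist (δ n) 0 < ρ := hδn
        simpa [NNReal.dist_eq] using this
      rw [NNReal.dist_eq, abs_lt]
      push_cast
      constructor <;> linarith
    · rw [gridExit_eq_zero g (not_exists.mp hk)]
      exact zero_le
  · have : ∀ n, gridExit U g (δ n) w = 0 := by
      refine fun n => gridExit_eq_zero g fun k hk => hw ⟨hk.1 0 zero_le, ?_⟩
      by_contra! h
      exact hk.2 fun u _ => h u
    simp [this]

/-- Brownian motion started in a co-regular open set cannot leave this set while staying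
in its closure for some more time. -/
lemma IsWiener.leave_inter_stayIn_closure {W : E d → Measure (PathSpace d)} (hW : IsWiener W)
    {U : Set (E d)} (hU : IsOpen U) (hreg : IsCoRegular W U) {x : E d} (hx : x ∈ U) {a b : ℝ≥0}
    (hab : a < b) : W x ((stayIn U a)ᶜ ∩ stayIn (closure U) b) = 0 := by
  have := (hW x).1
  obtain ⟨η, hη, hηb⟩ : ∃ η > 0, a + 2 * η ≤ b := by
    refine ⟨(b - a) / 2, by simpa using hab, ?_⟩
    rw [mul_div_cancel₀ _ two_ne_zero, add_tsub_cancel_of_le hab.le]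
  set C := stayIn (closure U) η
  have hC : MeasurableSet C := (isClosed_stayIn isClosed_closure η).measurableSet
  set h : E d → ℝ≥0∞ := fun y => W y C
  have hhm : Measurable h := hW.measurable_apply hC
  have hterm : ∀ (δ : ℝ≥0) (k : ℕ), Measurable
      ((leaveIn U δ k).indicator fun w : PathSpace d => h (w ((k + 1) * δ))) := fun δ k =>
    (hhm.comp (measurable_eval _)).indicator (measurableSet_leaveIn hU δ k)
  have hle : ∀ δ ≤ η, 0 < δ →
      W x ((stayIn U a)ᶜ ∩ stayIn (closure U) b) ≤ ∫⁻ w, gridExit U h δ w ∂(W x) := by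
    intro δ hδη hδ
    have hsub : ((stayIn U a)ᶜ ∩ stayIn (closure U) b : Set (PathSpace d)) ≤ᵐ[W x]
        (⋃ k : ℕ, leaveIn U δ k ∩ shiftBy ((k + 1) * δ) ⁻¹' C : Set (PathSpace d)) := by
      filter_upwards [(hW.isBrownianLaw x).ae_zero] with w hw0 hw
      obtain ⟨u, hu, huU⟩ : ∃ u ≤ a, w u ∉ U := by
        simpa [stayIn] using hw.1
      obtain ⟨m, hm⟩ := exists_nat_ge (u / δ)
      have hm' : u ≤ m * δ := (div_le_iff₀ hδ).mp hm
      have hex : ∃ k : ℕ, w ∉ stayIn U (k * δ) := ⟨m, fun h => huU (h u hm')⟩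
      classical
      obtain ⟨k, hk⟩ : ∃ k, Nat.find hex = k + 1 := by
        refine Nat.exists_eq_succ_of_ne_zero fun h => ?_
        have := Nat.find_spec hex
        rw [h] at this
        refine this fun v hv => ?_
        have : v = 0 := by simpa using hv
        rw [this, hw0]
        exact hx
      have hk1 : w ∉ stayIn U (((k + 1 : ℕ) : ℝ≥0) * δ) := hk ▸ Nat.find_spec hex
      have hk0 : w ∈ stayIn U (k * δ) := by
        by_contra h
        have := Nat.find_min' hex h
        omega
      have hka : k * δ ≤ a := by
        by_contra! h
        exact huU (hk0 u (hu.trans h.le))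
      refine Set.mem_iUnion.mpr ⟨k, ⟨hk0, by simpa using hk1⟩, fun v hv => ?_⟩
      refine hw.2 _ (le_trans ?_ hηb)
      calc (k + 1) * δ + v = k * δ + (δ + v) := by ring
        _ ≤ a + (η + η) := by gcongr
        _ = a + 2 * η := by ring
    calc _ ≤ _ := measure_mono_ae hsub
      _ ≤ ∑' k : ℕ, W x (leaveIn U δ k ∩ shiftBy ((k + 1) * δ) ⁻¹' C) := measure_iUnion_le _
      _ = ∑' k : ℕ, ∫⁻ w, (leaveIn U δ k).indicator (fun w => h (w ((k + 1) * δ))) w ∂(W x) := by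
          refine tsum_congr fun k => ?_
          rw [hW.markov x _ (measurableSet_leaveIn hU δ k) (fun w => ?_) hC,
            lintegral_indicator (measurableSet_leaveIn hU δ k)]
          refine and_congr (stopAt_mem_stayIn ?_ w) (not_congr (stopAt_mem_stayIn le_rfl w))
          gcongr
          exact le_self_add
      _ = _ := (lintegral_tsum fun k => (hterm δ k).aemeasurable).symm
  set δ : ℕ → ℝ≥0 := fun n => η / (n + 1)
  have hδ : Tendsto δ atTop (𝓝 0) := by
    have := (tendsto_one_div_add_atTop_nhds_zero_nat (𝕜 := ℝ≥0)).const_mul η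
    simpa [δ, div_eq_mul_inv] using this
  have hlim : Tendsto (fun n => ∫⁻ w, gridExit U h (δ n) w ∂(W x)) atTop (𝓝 0) := by
    rw [← lintegral_zero (μ := W x)]
    refine tendsto_lintegral_of_dominated_convergence (fun _ => 1)
      (fun n => Measurable.tsum fun k => hterm (δ n) k)
      (fun n => ae_of_all _ fun w => ?_) (by simp)
      (ae_of_all _ fun w => tendsto_gridExit hU
        (fun y hy => hW.tendsto_measure_stayIn_closure hreg hy hη) hδ w)
    by_cases hk : ∃ k, w ∈ leaveIn U (δ n) k
    · obtain ⟨k, hk⟩ := hk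
      rw [gridExit_eq h hk]
      have := (hW (w ((k + 1) * δ n))).1
      exact prob_le_one
    · rw [gridExit_eq_zero h (not_exists.mp hk)]
      exact zero_le
  refine le_antisymm (ge_of_tendsto' hlim fun n => hle (δ n) ?_ ?_) zero_le
  · exact div_le_self zero_le (by simp)
  · positivity

/-- Almost surely, either the path stays in `U` up to time `t` or it visits the exterior
of `U` before time `t`. -/
lemma IsWiener.ae_mem_stayIn_or {W : E d → Measure (PathSpace d)} (hW : IsWiener W)
    {U : Set (E d)} (hU : IsOpen U) (hreg : IsCoRegular W U) {x : E d} (hx : x ∈ U) {t : ℝ≥0}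
    (ht : 0 < t) : ∀ᵐ w ∂(W x), w ∈ stayIn U t ∨ ∃ s < t, w s ∉ closure U := by
  obtain ⟨D, hDc, hD⟩ := TopologicalSpace.exists_countable_dense ℝ≥0
  have hnull : ∀ᵐ w ∂(W x), ∀ a ∈ D, ∀ b ∈ D, a < b →
      w ∉ (stayIn U a)ᶜ ∩ stayIn (closure U) b := by
    refine (ae_ball_iff hDc).mpr fun a _ => (ae_ball_iff hDc).mpr fun b _ => ?_
    refine (ae_all_iff (ι := a < b)).mpr fun hab => ?_
    exact measure_eq_zero_iff_ae_notMem.mp (hW.leave_inter_stayIn_closure hU hreg hx hab)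
  filter_upwards [hnull, measure_eq_zero_iff_ae_notMem.mp (hW.leaveAt_eq_zero hU x ht)]
    with w hw hwt
  by_contra! hcon
  obtain ⟨v, hvt, hv⟩ : ∃ v ≤ t, w v ∉ U := by simpa [stayIn] using hcon.1
  obtain ⟨u, huv, hwu⟩ := exists_mem_leaveAt hU hv
  have hu := hwu.2
  have hlt : u < t := (huv.trans hvt).lt_of_ne fun h => hwt (h ▸ hwu)
  obtain ⟨a, ha, hua, hat⟩ := hD.exists_between hlt
  obtain ⟨b, hb, hab, hbt⟩ := hD.exists_between hat
  exact hw a ha b hb hab ⟨fun h => hu (h u hua.le), fun v hv => hcon.2 v (hv.trans_lt hbt)⟩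

lemma map_sub_prod_gaussianReal (v : ℝ≥0) :
    ((gaussianReal 0 v).prod (gaussianReal 0 v)).map (fun p => (√2)⁻¹ * (p.1 - p.2))
      = gaussianReal 0 v := by
  set P := (gaussianReal 0 v).prod (gaussianReal 0 v)
  have hX : P.map (fun p => id p.1) = gaussianReal 0 v := by simp [P]
  have hY : P.map (fun p => -p.2) = gaussianReal 0 v := by
    rw [show (fun p : ℝ × ℝ => -p.2) = (fun y => -y) ∘ Prod.snd from rfl,
      ← Measure.map_map measurable_neg measurable_snd]
    simp [P, gaussianReal_map_neg]
  have h := gaussianReal_add_gaussianReal_of_indepFun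
    (indepFun_prod measurable_id measurable_neg) hX hY
  have hcomp : (fun p : ℝ × ℝ => (√2)⁻¹ * (p.1 - p.2))
      = (fun y => (√2)⁻¹ * y) ∘ ((fun p : ℝ × ℝ => id p.1) + fun p => -p.2) := by
    funext p
    simp [sub_eq_add_neg]
  rw [hcomp, ← Measure.map_map (by fun_prop) (by fun_prop), h, gaussianReal_map_const_mul]
  congr 1
  · simp
  · ext
    simp
    ring

lemma map_sub_prod_pi_gaussianReal {ι : Type*} [Fintype ι] (v : ι → ℝ≥0) :
    ((Measure.pi fun i => gaussianReal 0 (v i)).prod (Measure.pi fun i => gaussianReal 0 (v i))).map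
        (fun z i => (√2)⁻¹ * (z.1 i - z.2 i))
      = Measure.pi fun i => gaussianReal 0 (v i) := by
  have h := measurePreserving_arrowProdEquivProdArrow ℝ ℝ ι
    (fun i => gaussianReal 0 (v i)) (fun i => gaussianReal 0 (v i))
  rw [← h.map_eq, Measure.map_map (by fun_prop) h.measurable]
  have hm : Measurable fun p : ℝ × ℝ => (√2)⁻¹ * (p.1 - p.2) := by fun_prop
  have := fun i => map_sub_prod_gaussianReal (v i)
  have hs : ∀ i, SigmaFinite (((gaussianReal 0 (v i)).prod (gaussianReal 0 (v i))).map
      fun p : ℝ × ℝ => (√2)⁻¹ * (p.1 - p.2)) := fun i => by rw [this i]; infer_instance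
  refine (Measure.pi_map_pi (f := fun _ (p : ℝ × ℝ) => (√2)⁻¹ * (p.1 - p.2)) fun i =>
    hm.aemeasurable).trans ?_
  simp_rw [this]

/-- The normalized difference of two independent Brownian motions is a Brownian motion. -/
lemma IsBrownianLaw.map_sub_prod {x : E d} {μ : Measure (PathSpace d)} (hμ : IsBrownianLaw x μ) :
    IsBrownianLaw 0 ((μ.prod μ).map fun p => (√2)⁻¹ • (p.1 - p.2)) := by
  have := hμ.1
  have hm : Measurable fun p : PathSpace d × PathSpace d => (√2)⁻¹ • (p.1 - p.2) :=
    Continuous.measurable (by fun_prop)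
  have hp := Measure.isProbabilityMeasure_map (μ := μ.prod μ) hm.aemeasurable
  refine ⟨hp, ?_, fun n t ht => ?_⟩
  · have h0 : MeasurableSet {w : PathSpace d | w 0 = 0} :=
      measurableSet_eq_fun (measurable_eval 0) measurable_const
    rw [Measure.map_apply hm h0]
    refine (prob_compl_eq_zero_iff (hm h0)).mp ?_
    have h1 : ∀ᵐ p ∂(μ.prod μ), p.1 0 = x := Measure.quasiMeasurePreserving_fst.ae hμ.ae_zero
    have h2 : ∀ᵐ p ∂(μ.prod μ), p.2 0 = x := Measure.quasiMeasurePreserving_snd.ae hμ.ae_zero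
    filter_upwards [h1, h2] with p hp1 hp2
    simp [hp1, hp2]
  · rw [Measure.map_map (measurable_increments t) hm, ← map_sub_prod_pi_gaussianReal,
      ← hμ.2.2 n t ht, Measure.map_prod_map _ _ (measurable_increments t) (measurable_increments t),
      Measure.map_map (by fun_prop)
        ((measurable_increments t).prodMap (measurable_increments t))]
    congr 1
    funext p i
    simp [increments]
    ring

/-- Brownian motion stays in a given open set containing its starting point with positive
probability. -/
lemma IsWiener.measure_stayIn_pos {W : E d → Measure (PathSpace d)} (hW : IsWiener W)
    {U : Set (E d)} (hU : IsOpen U) {x : E d} (hx : x ∈ U) (t : ℝ≥0) : 0 < W x (stayIn U t) := by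
  have := (hW 0).1
  obtain ⟨r, hr, hball⟩ := Metric.isOpen_iff.mp hU x hx
  obtain ⟨g, hg⟩ := Measure.nonempty_support (IsProbabilityMeasure.ne_zero (W 0))
  have hshift : Continuous fun w : PathSpace d => w - g := by fun_prop
  set V : Set (PathSpace d) := (fun w => w - g) ⁻¹' stayIn (Metric.ball 0 (r / 2)) t
  have hV : 0 < W 0 V := (Measure.mem_support_iff_forall g).mp hg V
    (((isOpen_stayIn Metric.isOpen_ball t).preimage hshift).mem_nhds fun u _ => by simpa using hr)
  have hopen := isOpen_stayIn hU t
  rw [(hW.isBrownianLaw x).eq_map_translatePath (hW.isBrownianLaw 0),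
    Measure.map_apply (measurable_translatePath_left x) hopen.measurableSet,
    (hW.isBrownianLaw 0).unique (hW.isBrownianLaw 0).map_sub_prod, Measure.map_apply
      (Continuous.measurable (by fun_prop)) (measurable_translatePath_left x hopen.measurableSet)]
  refine lt_of_lt_of_le (ENNReal.mul_pos hV.ne' hV.ne') ?_
  rw [← Measure.prod_prod]
  refine measure_mono fun p hp u hu => hball ?_
  have h1 : ‖p.1 u - g u‖ < r / 2 := by simpa using hp.1 u hu
  have h2 : ‖p.2 u - g u‖ < r / 2 := by simpa using hp.2 u hu
  have h3 : ‖p.1 u - p.2 u‖ < r := by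
    calc ‖p.1 u - p.2 u‖ = ‖(p.1 u - g u) - (p.2 u - g u)‖ := by congr 1; abel
      _ ≤ ‖p.1 u - g u‖ + ‖p.2 u - g u‖ := norm_sub_le _ _
      _ < r := by linarith
  have h4 : (√2)⁻¹ ≤ 1 := inv_le_one_of_one_le₀ (Real.one_le_sqrt.mpr one_le_two)
  rw [mem_ball_iff_norm]
  calc ‖translatePath (x, (√2)⁻¹ • (p.1 - p.2)) u - x‖ = (√2)⁻¹ * ‖p.1 u - p.2 u‖ := by
        simp [norm_smul]
    _ ≤ 1 * ‖p.1 u - p.2 u‖ := by gcongr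
    _ < r := by rwa [one_mul]

lemma condLawT_eq {W : E d → Measure (PathSpace d)} (hW : IsWiener W)
    {U : Set (E d)} (hU : IsOpen U) {x : E d} (hx : x ∈ U) {t : ℝ} (ht : 0 < t) :
    condLawT W U x t = cond (W x) (stayIn U t.toNNReal) := by
  have hae : ({w | ENNReal.ofReal t < exitTime U w} : Set (PathSpace d))
      =ᵐ[W x] stayIn U t.toNNReal := by
    filter_upwards [(hW.isBrownianLaw x).ae_zero] with w hw
    exact propext (lt_exitTime_iff hU (hw ▸ hx) t.toNNReal)
  rw [condLawT, if_neg ht.not_ge, ProbabilityTheory.cond, ProbabilityTheory.cond,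
    measure_congr hae, Measure.restrict_congr_set hae]

/-- The restricted expectations of Brownian motion depend continuously on the starting point
and on the time. -/
lemma IsWiener.continuousAt_setIntegral_stayIn {W : E d → Measure (PathSpace d)} (hW : IsWiener W)
    {U : Set (E d)} (hU : IsOpen U) (hreg : IsCoRegular W U)
    (g : BoundedContinuousFunction (PathSpace d) ℝ) {x : E d} (hx : x ∈ U) {t : ℝ} (ht : 0 < t) :
    ContinuousAt (fun p : E d × ℝ => ∫ w in stayIn U p.2.toNNReal, g w ∂(W p.1)) (x, t) := by
  have := (hW 0).1
  have hS : ∀ s, MeasurableSet (stayIn U s) := fun s => (isOpen_stayIn hU s).measurableSet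
  have hrep : ∀ p : E d × ℝ, ∫ w in stayIn U p.2.toNNReal, g w ∂(W p.1)
      = ∫ b, (stayIn U p.2.toNNReal).indicator g (translatePath (p.1, b)) ∂(W 0) := by
    intro p
    rw [(hW.isBrownianLaw p.1).eq_map_translatePath (hW.isBrownianLaw 0),
      ← integral_indicator (hS _), integral_map (measurable_translatePath_left _).aemeasurable
        (g.continuous.measurable.indicator (hS _)).aestronglyMeasurable]
  have hae : ∀ᵐ b ∂(W 0), translatePath (x, b) ∈ stayIn U t.toNNReal ∨
      ∃ s < t.toNNReal, translatePath (x, b) s ∉ closure U := by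
    have h := hW.ae_mem_stayIn_or hU hreg hx (Real.toNNReal_pos.mpr ht)
    rw [(hW.isBrownianLaw x).eq_map_translatePath (hW.isBrownianLaw 0)] at h
    exact ae_of_ae_map (measurable_translatePath_left _).aemeasurable h
  simp_rw [hrep]
  refine tendsto_integral_filter_of_dominated_convergence (fun _ => ‖g‖)
    (.of_forall fun p => ((g.continuous.measurable.indicator (hS _)).comp
      (measurable_translatePath_left _)).aestronglyMeasurable)
    (.of_forall fun p => ae_of_all _ fun b =>
      (norm_indicator_le_norm_self _ _).trans (g.norm_coe_le_norm _))
    (integrable_const _) ?_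
  filter_upwards [hae] with b hb
  have htime : Continuous fun p : E d × ℝ => p.2.toNNReal := by fun_prop
  have hpath : Continuous fun p : E d × ℝ => translatePath (p.1, b) := by fun_prop
  rcases hb with hb | ⟨s, hs, hb⟩
  · obtain ⟨t', ht', hbt'⟩ := exists_gt_mem_stayIn hU hb
    have h1 : ∀ᶠ p : E d × ℝ in 𝓝 (x, t), p.2.toNNReal < t' :=
      htime.continuousAt.eventually_lt_const ht'
    have h2 : ∀ᶠ p : E d × ℝ in 𝓝 (x, t), translatePath (p.1, b) ∈ stayIn U t' :=
      hpath.continuousAt.eventually ((isOpen_stayIn hU t').mem_nhds hbt')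
    rw [Set.indicator_of_mem hb]
    refine ((g.continuous.comp hpath).tendsto (x, t)).congr' ?_
    filter_upwards [h1, h2] with p hp1 hp2
    exact (Set.indicator_of_mem (stayIn_anti U hp1.le hp2) _).symm
  · have h1 : ∀ᶠ p : E d × ℝ in 𝓝 (x, t), s < p.2.toNNReal :=
      htime.continuousAt.eventually_const_lt hs
    have h2 : ∀ᶠ p : E d × ℝ in 𝓝 (x, t), translatePath (p.1, b) s ∈ (closure U)ᶜ :=
      ((continuous_eval s).comp hpath).continuousAt.eventually
        (isClosed_closure.isOpen_compl.mem_nhds hb)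
    have hb' : translatePath (x, b) ∉ stayIn U t.toNNReal := fun h =>
      hb (subset_closure (h s hs.le))
    rw [Set.indicator_of_notMem hb']
    refine tendsto_const_nhds.congr' ?_
    filter_upwards [h1, h2] with p hp1 hp2
    have hp : translatePath (p.1, b) ∉ stayIn U p.2.toNNReal := fun h =>
      hp2 (subset_closure (h s hp1.le))
    exact (Set.indicator_of_notMem hp _).symm

/-- **Continuity of the conditioned laws** (Proposition 2.2): if `U` is an open co-regular
set then, for every bounded continuous `f`, the map `(x, t) ↦ W̃^U_{x,t}(f)` is continuous
on `U × (0, ∞)`. -/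
theorem condLaw_continuousOn {d : ℕ}
    (W : E d → Measure (PathSpace d)) (hW : IsWiener W)
    (U : Set (E d)) (hU : IsOpen U) (hreg : IsCoRegular W U)
    (f : BoundedContinuousFunction (PathSpace d) ℝ) :
    ContinuousOn (fun p : E d × ℝ => ∫ w, f w ∂(condLawT W U p.1 p.2))
      (U ×ˢ Set.Ioi (0 : ℝ)) := by
  have hrep : ∀ p ∈ U ×ˢ Set.Ioi (0 : ℝ), ∫ w, f w ∂(condLawT W U p.1 p.2)
      = (∫ w in stayIn U p.2.toNNReal, (1 : BoundedContinuousFunction (PathSpace d) ℝ) w ∂(W p.1))⁻¹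
        * ∫ w in stayIn U p.2.toNNReal, f w ∂(W p.1) := by
    rintro ⟨x, t⟩ ⟨hx, ht⟩
    have := (hW x).1
    rw [condLawT_eq hW hU hx ht, ProbabilityTheory.cond, integral_smul_measure]
    simp [Measure.real]
  refine ContinuousOn.congr (fun p hp => ?_) hrep
  obtain ⟨hx, ht⟩ := hp
  refine ContinuousAt.continuousWithinAt (ContinuousAt.mul (ContinuousAt.inv₀
    (hW.continuousAt_setIntegral_stayIn hU hreg 1 hx ht) ?_)
    (hW.continuousAt_setIntegral_stayIn hU hreg f hx ht))
  have := (hW p.1).1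
  simpa [Measure.real, ENNReal.toReal_eq_zero_iff] using
    (hW.measure_stayIn_pos hU hx p.2.toNNReal).ne'

end
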